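/- As h → −1⁺ one has the asymptotic expansions Ī₀(h) = (π/4)(h+1) + (3π/128)(h+1)² + o((h+1)²) and Ī₂(h) = (π/4)(h+1) − (π/128)(h+1)² + o((h+1)²); that is, Ī₀(h) − (π/4)(h+1) − (3π/128)(h+1)² is little-o of (h+1)² and Ī₂(h) − (π/4)(h+1) + (π/128)(h+1)² is little-o of (h+1)² as h tends to −1 from the right. -/

import Mathlib

open intervalIntegral Real Filter Asymptotics

/-- `Ī_k(h) = ∫_{u₁(h)}^{u₂(h)} u^k √(h + 2u² − u⁴) du` where
`u₁(h) = √(1 − √(1+h))` and `u₂(h) = √(1 + √(1+h))`. -/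
noncomputable def Ibar (k : ℕ) (h : ℝ) : ℝ :=
  ∫ u in (Real.sqrt (1 - Real.sqrt (1 + h)))..(Real.sqrt (1 + Real.sqrt (1 + h))),
    u ^ k * Real.sqrt (h + 2 * u ^ 2 - u ^ 4)

/-- The substitution `u = √(1 + r sin θ)` with `r = √(1 + h)`. -/
lemma Ibar_eq_integral_trig (k : ℕ) {r : ℝ} (hr0 : 0 < r) (hr1 : r < 1) :
    Ibar k (r ^ 2 - 1) = ∫ θ in (-(π / 2))..(π / 2),
      r ^ 2 / 2 * cos θ ^ 2 * (√(1 + r * sin θ) ^ k / √(1 + r * sin θ)) := by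
  have hpos : ∀ θ, 0 < 1 + r * sin θ := fun θ => by
    nlinarith [neg_one_le_sin θ]
  have hroot : √(1 + (r ^ 2 - 1)) = r := by
    rw [add_sub_cancel, sqrt_sq hr0.le]
  have key := integral_comp_mul_deriv (a := -(π / 2)) (b := π / 2)
    (f := fun θ => √(1 + r * sin θ)) (f' := fun θ => r * cos θ / (2 * √(1 + r * sin θ)))
    (g := fun u => u ^ k * √((r ^ 2 - 1) + 2 * u ^ 2 - u ^ 4))
    (fun θ _ => (((hasDerivAt_sin θ).const_mul r).const_add 1).sqrt (hpos θ).ne')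
    (by
      apply Continuous.continuousOn
      apply Continuous.div (by fun_prop) (by fun_prop)
      intro θ
      have := sqrt_pos.2 (hpos θ)
      positivity)
    (by fun_prop)
  simp only [sin_neg, sin_pi_div_two, mul_neg, mul_one, ← sub_eq_add_neg] at key
  rw [Ibar, hroot, ← key]
  apply integral_congr
  intro θ hθ
  rw [Set.uIcc_of_le (by linarith [pi_pos])] at hθ
  have hcos : 0 ≤ cos θ := cos_nonneg_of_mem_Icc hθ
  have hs := sqrt_pos.2 (hpos θ)
  have hsq := sq_sqrt (hpos θ).le
  have hval : √((r ^ 2 - 1) + 2 * √(1 + r * sin θ) ^ 2 - √(1 + r * sin θ) ^ 4) = r * cos θ := by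
    rw [← sqrt_sq (mul_nonneg hr0.le hcos)]
    congr 1
    rw [show √(1 + r * sin θ) ^ 4 = (√(1 + r * sin θ) ^ 2) ^ 2 by ring, hsq, mul_pow, cos_sq']
    ring
  simp only [Function.comp_apply, hval]
  field_simp

lemma integral_cos_sq_mul_quadratic (r a b c : ℝ) :
    ∫ θ in (-(π / 2))..(π / 2),
      r ^ 2 / 2 * cos θ ^ 2 * (a + b * (r * sin θ) + c * (r * sin θ) ^ 2) =
      π / 4 * a * r ^ 2 + π / 16 * c * r ^ 4 := by
  have h := integral_eq_sub_of_hasDerivAt (a := -(π / 2)) (b := π / 2)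
    (f := fun θ => r ^ 2 / 2 * (a * ((θ + sin θ * cos θ) / 2) - b * r * (cos θ ^ 3 / 3)
      + c * r ^ 2 * ((θ - sin θ * cos θ * (1 - 2 * sin θ ^ 2)) / 8)))
    (f' := fun θ => r ^ 2 / 2 * cos θ ^ 2 * (a + b * (r * sin θ) + c * (r * sin θ) ^ 2))
    (fun θ _ => by
      have hs := hasDerivAt_sin θ
      have hc := hasDerivAt_cos θ
      have h1 := (((hasDerivAt_id θ).add (hs.mul hc)).div_const 2).const_mul a
      have h2 := ((hc.pow 3).div_const 3).const_mul (b * r)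
      have h3 := ((((hasDerivAt_id θ).sub ((hs.mul hc).mul
        (((hs.pow 2).const_mul 2).const_sub 1))).div_const 8)).const_mul (c * r ^ 2)
      refine (((h1.sub h2).add h3).const_mul (r ^ 2 / 2)).congr_deriv ?_
      have hsc : sin θ ^ 2 = 1 - cos θ ^ 2 := sin_sq θ
      have hsc4 : sin θ ^ 4 = (1 - cos θ ^ 2) ^ 2 := by rw [← hsc]; ring
      simp
      ring_nf
      simp only [hsc, hsc4]
      ring)
    (Continuous.intervalIntegrable (by fun_prop) _ _)
  rw [h]
  simp
  ring

lemma abs_sqrt_one_add_sub_quadratic_le {x : ℝ} (hx : |x| ≤ 1 / 2) :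
    |√(1 + x) - (1 + 1 / 2 * x + -1 / 8 * x ^ 2)| ≤ 10 * |x| ^ 3 ∧
    |1 / √(1 + x) - (1 + -1 / 2 * x + 3 / 8 * x ^ 2)| ≤ 10 * |x| ^ 3 := by
  obtain ⟨hx1, hx2⟩ := abs_le.1 hx
  have hsq := sq_sqrt (show 0 ≤ 1 + x by linarith)
  have hs1 : 1 / 2 ≤ √(1 + x) := le_sqrt_of_sq_le (by linarith)
  have hs2 : √(1 + x) ≤ 2 := sqrt_le_iff.2 ⟨by norm_num, by linarith⟩
  generalize √(1 + x) = s at *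
  obtain rfl : x = (s - 1) * (s + 1) := by linarith
  have hle : |s - 1| ^ 3 ≤ |(s - 1) * (s + 1)| ^ 3 := by
    refine pow_le_pow_left₀ (abs_nonneg _) ?_ 3
    rw [abs_mul, abs_of_pos (by linarith : 0 < s + 1)]
    nlinarith [abs_nonneg (s - 1)]
  have bound : ∀ q : ℝ, 0 ≤ q → q ≤ 10 →
      |-((s - 1) ^ 3 * q)| ≤ 10 * |(s - 1) * (s + 1)| ^ 3 := fun q h0 h1 => by
    rw [abs_neg, abs_mul, abs_pow, abs_of_nonneg h0]
    nlinarith [pow_nonneg (abs_nonneg (s - 1)) 3]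
  constructor
  · rw [abs_sub_comm]
    convert bound ((s + 3) / 8) (by linarith) (by linarith) using 2
    ring
  · convert bound ((3 * s ^ 2 + 9 * s + 8) / (8 * s)) (by positivity)
      (by rw [div_le_iff₀ (by positivity)]; nlinarith) using 2
    field_simp
    ring

lemma Ibar_isLittleO {k : ℕ} {a b c : ℝ}
    (hg : ∀ x : ℝ, |x| ≤ 1 / 2 →
      |√(1 + x) ^ k / √(1 + x) - (a + b * x + c * x ^ 2)| ≤ 10 * |x| ^ 3) :
    (fun h : ℝ => Ibar k h - (π / 4 * a * (h + 1) + π / 16 * c * (h + 1) ^ 2))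
      =o[nhdsWithin (-1) (Set.Ioi (-1 : ℝ))] (fun h : ℝ => (h + 1) ^ 2) := by
  have hbound : ∀ r : ℝ, 0 < r → r < 1 / 2 →
      |Ibar k (r ^ 2 - 1) - (π / 4 * a * r ^ 2 + π / 16 * c * r ^ 4)| ≤ 5 * π * r * r ^ 4 := by
    intro r hr0 hr1
    have hpos : ∀ θ, 0 < 1 + r * sin θ := fun θ => by
      nlinarith [neg_one_le_sin θ]
    rw [Ibar_eq_integral_trig k hr0 (by linarith), ← integral_cos_sq_mul_quadratic r a b c,
      ← integral_sub]
    · have := norm_integral_le_of_norm_le_const (a := -(π / 2)) (b := π / 2)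
        (C := 5 * r ^ 5)
        (f := fun θ => r ^ 2 / 2 * cos θ ^ 2 * (√(1 + r * sin θ) ^ k / √(1 + r * sin θ))
          - r ^ 2 / 2 * cos θ ^ 2 * (a + b * (r * sin θ) + c * (r * sin θ) ^ 2))
        (fun θ _ => by
          have hle : |r * sin θ| ≤ r := by
            rw [abs_mul, abs_of_pos hr0]
            nlinarith [abs_sin_le_one θ]
          have h1 := hg (r * sin θ) (by linarith)
          have h2 : |r * sin θ| ^ 3 ≤ r ^ 3 := by gcongr
          rw [← mul_sub, norm_eq_abs, abs_mul, abs_of_nonneg (by positivity)]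
          calc _ ≤ r ^ 2 / 2 * 1 * (10 * r ^ 3) := by
                gcongr
                · exact cos_sq_le_one θ
                · linarith
            _ = 5 * r ^ 5 := by ring)
      rw [norm_eq_abs] at this
      refine this.trans_eq ?_
      rw [abs_of_pos (by linarith [pi_pos])]
      ring
    · apply Continuous.intervalIntegrable
      refine Continuous.mul (by fun_prop) (Continuous.div (by fun_prop) (by fun_prop) ?_)
      exact fun θ => (sqrt_pos.2 (hpos θ)).ne'
    · exact Continuous.intervalIntegrable (by fun_prop) _ _
  rw [isLittleO_iff]
  intro ε hε
  have hlim : Tendsto (fun h : ℝ => √(h + 1)) (nhdsWithin (-1) (Set.Ioi (-1 : ℝ))) (nhds 0) := by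
    have : Continuous fun h : ℝ => √(h + 1) := by fun_prop
    simpa using (this.tendsto (-1)).mono_left nhdsWithin_le_nhds
  filter_upwards [self_mem_nhdsWithin, hlim.eventually_lt_const (show (0 : ℝ) < 1 / 2 by norm_num),
    hlim.eventually_lt_const (show 0 < ε / (5 * π) by positivity)] with h hh h1 h2
  have hh' : 0 < h + 1 := by linarith [Set.mem_Ioi.1 hh]
  have hr := sqrt_pos.2 hh'
  have hsq := sq_sqrt hh'.le
  have key := hbound _ hr h1
  have h4 : √(h + 1) ^ 4 = (h + 1) ^ 2 := by rw [← hsq, ← pow_mul, hsq]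
  rw [h4, hsq, add_sub_cancel_right] at key
  rw [lt_div_iff₀ (by positivity)] at h2
  rw [norm_eq_abs, norm_eq_abs, abs_of_nonneg (sq_nonneg (h + 1))]
  refine key.trans ?_
  gcongr
  linarith

/-- As `h → −1⁺`,
`Ī₀(h) = (π/4)(h+1) + (3π/128)(h+1)² + o((h+1)²)` and
`Ī₂(h) = (π/4)(h+1) − (π/128)(h+1)² + o((h+1)²)`. -/
theorem stmt9 :
    (fun h : ℝ =>
        Ibar 0 h - Real.pi / 4 * (h + 1) - 3 * Real.pi / 128 * (h + 1) ^ 2)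
      =o[nhdsWithin (-1) (Set.Ioi (-1 : ℝ))] (fun h : ℝ => (h + 1) ^ 2) ∧
    (fun h : ℝ =>
        Ibar 2 h - Real.pi / 4 * (h + 1) + Real.pi / 128 * (h + 1) ^ 2)
      =o[nhdsWithin (-1) (Set.Ioi (-1 : ℝ))] (fun h : ℝ => (h + 1) ^ 2) := by
  constructor
  · refine (Ibar_isLittleO (k := 0) (a := 1) (b := -1 / 2) (c := 3 / 8) fun x hx => ?_).congr_left
      fun h => by ring
    simpa only [pow_zero] using (abs_sqrt_one_add_sub_quadratic_le hx).2
  · refine (Ibar_isLittleO (k := 2) (a := 1) (b := 1 / 2) (c := -1 / 8) fun x hx => ?_).congr_left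
      fun h => by ring
    rw [pow_two, mul_self_div_self]
    exact (abs_sqrt_one_add_sub_quadratic_le hx).1
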